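/- Let (S,R) be an Artin-Tits presentation with S = S₁ ∪ S₂ and S₁,₂ = S₁ ∩ S₂, and let (S₁,R₁), (S₂,R₂), (S₁,₂,R₁,₂) be the induced Artin-Tits presentations of the standard parabolic subgroups A_{S₁}, A_{S₂}, A_{S₁,₂} of A_S. Assume that A_S is canonically isomorphic to the amalgamated product A_{S₁} *_{A_{S₁,₂}} A_{S₂} and that each of (S₁,R₁), (S₂,R₂), (S₁,₂,R₁,₂) satisfies Property H⁺. Then (S,R) satisfies Property H. -/

import Mathlib

namespace ArtinTits

open Classical List

variable {S : Type*}

/-- A word over `S ∪ S⁻¹`: a list of letters, each a generator together with a sign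
(`true` = the generator itself, `false` = its formal inverse). -/
abbrev Word (S : Type*) := List (S × Bool)

/-- The formal inverse of a word. -/
def wordInv (w : Word S) : Word S := w.reverse.map fun l => (l.1, !l.2)

/-- `[x,y,j⟩`: the alternating positive word `xyxy⋯` with `j` letters, beginning with `x`. -/
def altWord (x y : S) : ℕ → Word S
  | 0 => []
  | j + 1 => (x, true) :: altWord y x j

/-- `⟨x,y,j]`: the alternating positive word `⋯xy` with `j` letters, ending with `y`. -/
def altWordR (x y : S) (j : ℕ) : Word S := (altWord y x j).reverse

/-- The data of a labelled finite complete simplicial graph `Γ₀`: a symmetric label map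
with values in `{2,3,…} ∪ {∞}` on pairs of distinct vertices. -/
structure ArtinData (S : Type*) where
  m : S → S → ℕ∞
  symm : ∀ s t, m s t = m t s
  two_le : ∀ s t : S, s ≠ t → 2 ≤ m s t

/-- `u = v` is a defining (braid) relation of the Artin–Tits presentation. -/
def IsRel (A : ArtinData S) (u v : Word S) : Prop :=
  ∃ (s t : S) (k : ℕ), s ≠ t ∧ A.m s t = (k : ℕ∞) ∧
    u = altWord s t k ∧ v = altWord t s k

/-- The relator set of the Artin–Tits presentation, inside the free group. -/
def rels (A : ArtinData S) : Set (FreeGroup S) :=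
  {x | ∃ u v : Word S, IsRel A u v ∧ x = FreeGroup.mk u * (FreeGroup.mk v)⁻¹}

/-- The Artin–Tits group `A(Γ₀)` of the presentation. -/
abbrev ArtinGroup (A : ArtinData S) := PresentedGroup (rels A)

/-- `w̄`: the element of the Artin–Tits group represented by the word `w`. -/
def wbar (A : ArtinData S) (w : Word S) : ArtinGroup A :=
  PresentedGroup.mk (rels A) (FreeGroup.mk w)

/-! ### Special transformations -/

/-- Type 0: delete a factor `s s⁻¹` or `s⁻¹ s`. -/
def Step0 (w w' : Word S) : Prop :=
  ∃ (w₁ w₂ : Word S) (s : S) (b : Bool),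
    w = w₁ ++ [(s, b), (s, !b)] ++ w₂ ∧ w' = w₁ ++ w₂

/-- Type ∞: insert a factor `s s⁻¹` or `s⁻¹ s` (the inverse of type 0). -/
def StepInfty (w w' : Word S) : Prop := Step0 w' w

/-- Type 1: replace a factor `v` by `u`, or `v⁻¹` by `u⁻¹`, where `u = v` is a defining
relation. -/
def Step1 (A : ArtinData S) (w w' : Word S) : Prop :=
  ∃ (w₁ w₂ u v : Word S), IsRel A u v ∧
    ((w = w₁ ++ v ++ w₂ ∧ w' = w₁ ++ u ++ w₂) ∨
     (w = w₁ ++ wordInv v ++ w₂ ∧ w' = w₁ ++ wordInv u ++ w₂))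

/-- Type 2r: for a defining relation `u₁u₂ = v₁v₂` with `u₁, v₁` non-empty, replace a factor
`v₁⁻¹ u₁` by `v₂ u₂⁻¹`. -/
def Step2r (A : ArtinData S) (w w' : Word S) : Prop :=
  ∃ (w₁ w₂ u₁ u₂ v₁ v₂ : Word S), IsRel A (u₁ ++ u₂) (v₁ ++ v₂) ∧
    u₁ ≠ [] ∧ v₁ ≠ [] ∧
    w = w₁ ++ wordInv v₁ ++ u₁ ++ w₂ ∧ w' = w₁ ++ v₂ ++ wordInv u₂ ++ w₂

/-- Type 2l: for a defining relation `u₁u₂ = v₁v₂` with `u₂, v₂` non-empty, replace a factor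
`v₂ u₂⁻¹` by `v₁⁻¹ u₁`. -/
def Step2l (A : ArtinData S) (w w' : Word S) : Prop :=
  ∃ (w₁ w₂ u₁ u₂ v₁ v₂ : Word S), IsRel A (u₁ ++ u₂) (v₁ ++ v₂) ∧
    u₂ ≠ [] ∧ v₂ ≠ [] ∧
    w = w₁ ++ v₂ ++ wordInv u₂ ++ w₂ ∧ w' = w₁ ++ wordInv v₁ ++ u₁ ++ w₂

/-- Type 2: a type 2r or type 2l transformation. -/
def Step2 (A : ArtinData S) (w w' : Word S) : Prop := Step2r A w w' ∨ Step2l A w w'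

/-- `p` is the greatest (longest) common left factor of `x` and `y`. -/
def IsLCPrefix (p x y : Word S) : Prop :=
  p <+: x ∧ p <+: y ∧ ∀ q : Word S, q <+: x → q <+: y → q.length ≤ p.length

/-- `p` is the greatest (longest) common right factor of `x` and `y`. -/
def IsLCSuffix (p x y : Word S) : Prop :=
  p <:+ x ∧ p <:+ y ∧ ∀ q : Word S, q <:+ x → q <:+ y → q.length ≤ p.length

/-- Type 2r⋆ : a type 2r transformation `w₁ v⁻¹ v' w₂ → w₁ u (u')⁻¹ w₂` (with `vu = v'u'` a
defining relation) such that `v` is the greatest common left factor of `vu` and `v w₁⁻¹`, and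
`v'` is the greatest common left factor of `v'u'` and `v' w₂`. -/
def Step2rStar (A : ArtinData S) (w w' : Word S) : Prop :=
  ∃ (w₁ w₂ v u v' u' : Word S), IsRel A (v ++ u) (v' ++ u') ∧
    v ≠ [] ∧ v' ≠ [] ∧
    w = w₁ ++ wordInv v ++ v' ++ w₂ ∧
    w' = w₁ ++ u ++ wordInv u' ++ w₂ ∧
    IsLCPrefix v (v ++ u) (v ++ wordInv w₁) ∧
    IsLCPrefix v' (v' ++ u') (v' ++ w₂)

/-- Type 2l⋆ : a type 2l transformation `w₁ v (v')⁻¹ w₂ → w₁ u⁻¹ u' w₂` (with `uv = u'v'` a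
defining relation) such that `v` is the greatest common right factor of `uv` and `w₁ v`, and
`v'` is the greatest common right factor of `u'v'` and `w₂⁻¹ v'`. -/
def Step2lStar (A : ArtinData S) (w w' : Word S) : Prop :=
  ∃ (w₁ w₂ v u v' u' : Word S), IsRel A (u ++ v) (u' ++ v') ∧
    v ≠ [] ∧ v' ≠ [] ∧
    w = w₁ ++ v ++ wordInv v' ++ w₂ ∧
    w' = w₁ ++ wordInv u ++ u' ++ w₂ ∧
    IsLCSuffix v (u ++ v) (w₁ ++ v) ∧
    IsLCSuffix v' (u' ++ v') (wordInv w₂ ++ v')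

/-- Type 2⋆ : a type 2r⋆ or type 2l⋆ transformation. -/
def Step2Star (A : ArtinData S) (w w' : Word S) : Prop :=
  Step2rStar A w w' ∨ Step2lStar A w w'

/-- `w →_{0,1,2} w'`. -/
def Steps012 (A : ArtinData S) : Word S → Word S → Prop :=
  Relation.ReflTransGen fun x y => Step0 x y ∨ Step1 A x y ∨ Step2 A x y

/-- `w →_{0,1,2⋆} w'`. -/
def Steps012Star (A : ArtinData S) : Word S → Word S → Prop :=
  Relation.ReflTransGen fun x y => Step0 x y ∨ Step1 A x y ∨ Step2Star A x y

/-- `w →_{2⋆} w'`. -/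
def Steps2Star (A : ArtinData S) : Word S → Word S → Prop :=
  Relation.ReflTransGen (Step2Star A)

/-- `w →_{1,2⋆} w'`. -/
def Steps12Star (A : ArtinData S) : Word S → Word S → Prop :=
  Relation.ReflTransGen fun x y => Step1 A x y ∨ Step2Star A x y

/-- `w →_{1,2} w'`. -/
def Steps12 (A : ArtinData S) : Word S → Word S → Prop :=
  Relation.ReflTransGen fun x y => Step1 A x y ∨ Step2 A x y

/-! ### Classes of words -/

/-- A positive word: written over `S`. -/
def Positive (w : Word S) : Prop := ∀ l ∈ w, l.2 = true

/-- A negative word: written over `S⁻¹`. -/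
def Negative (w : Word S) : Prop := ∀ l ∈ w, l.2 = false

/-- A signed word: positive or negative. -/
def Signed (w : Word S) : Prop := Positive w ∨ Negative w

/-- An unsigned word: neither positive nor negative. -/
def Unsigned (w : Word S) : Prop := ¬ Positive w ∧ ¬ Negative w

/-- A freely reduced word: no factor `s s⁻¹` or `s⁻¹ s`. -/
def FreelyReduced (w : Word S) : Prop :=
  ∀ (w₁ w₂ : Word S) (s : S) (b : Bool), w ≠ w₁ ++ [(s, b), (s, !b)] ++ w₂

/-- A square-free word: no factor `aa`. -/
def SquareFree (w : Word S) : Prop := ∀ a : S × Bool, ¬ [a, a] <:+: w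

/-- `p̃(w)`: the length of the longest square-free positive factor of `w`. -/
noncomputable def ptilde (w : Word S) : ℕ :=
  sSup {n | ∃ v : Word S, v <:+: w ∧ Positive v ∧ SquareFree v ∧ v.length = n}

/-- `ñ(w)`: the length of the longest negative factor of `w` whose formal inverse is
square-free. -/
noncomputable def ntilde (w : Word S) : ℕ :=
  sSup {n | ∃ v : Word S, v <:+: w ∧ Negative v ∧ SquareFree (wordInv v) ∧ v.length = n}

/-- `p(w) = min(p̃(w), m)`. -/
noncomputable def pfun (M : ℕ) (w : Word S) : ℕ := min (ptilde w) M

/-- `n(w) = min(ñ(w), m)`. -/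
noncomputable def nfun (M : ℕ) (w : Word S) : ℕ := min (ntilde w) M

/-- `Ω(Γ₀)` (for a dihedral presentation with label `M`): the freely reduced words with
`max(p(w), n(w)) < M`. -/
def Omega (M : ℕ) (w : Word S) : Prop :=
  FreelyReduced w ∧ max (pfun M w) (nfun M w) < M

/-- A signed square-free word (square-free positive, or negative with square-free inverse). -/
def SignedSF (w : Word S) : Prop :=
  (Positive w ∧ SquareFree w) ∨ (Negative w ∧ SquareFree (wordInv w))

/-- `v` is the maximal square-free signed left factor of `w`. -/
def MaxSignedSFPrefix (v w : Word S) : Prop :=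
  v <+: w ∧ SignedSF v ∧ ∀ v' : Word S, v' <+: w → SignedSF v' → v'.length ≤ v.length

/-- `(v₁, …, v_k)` is the `⋆`-decomposition of `w`: the `v_i` are non-empty, `w = v₁⋯v_k`,
and each `v_i` is the maximal square-free signed left factor of `v_i⋯v_k`. -/
def StarDecomp (w : Word S) (L : List (Word S)) : Prop :=
  w = L.flatten ∧ (∀ v ∈ L, v ≠ ([] : Word S)) ∧
    ∀ i (h : i < L.length), MaxSignedSFPrefix (L.get ⟨i, h⟩) ((L.drop i).flatten)

/-! ### Groups, parabolic subgroups, geodesics -/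

/-- A word written over `T ∪ T⁻¹` for a subset `T` of the generators. -/
def WordOver (T : Set S) (w : Word S) : Prop := ∀ l ∈ w, l.1 ∈ T

/-- The standard parabolic subgroup `A_T` generated by the image of `T ⊆ S`. -/
def parab (A : ArtinData S) (T : Set S) : Subgroup (ArtinGroup A) :=
  Subgroup.closure {x | ∃ s ∈ T, x = wbar A [(s, true)]}

/-- A geodesic word: of minimal length among all words representing the same element. -/
def Geodesic (A : ArtinData S) (w : Word S) : Prop :=
  ∀ w' : Word S, wbar A w' = wbar A w → w.length ≤ w'.length

/-- A word over `T ∪ T⁻¹` that is geodesic among the words over `T ∪ T⁻¹` representing the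
same element. -/
def GeodesicOver (A : ArtinData S) (T : Set S) (w : Word S) : Prop :=
  WordOver T w ∧
    ∀ w' : Word S, WordOver T w' → wbar A w' = wbar A w → w.length ≤ w'.length

/-- The length of a group element: the length of any geodesic representative word. -/
noncomputable def elLength (A : ArtinData S) (g : ArtinGroup A) : ℕ :=
  sInf {n | ∃ w : Word S, wbar A w = g ∧ w.length = n}

/-- A positive element: one represented by a positive word. -/
def IsPosElt (A : ArtinData S) (g : ArtinGroup A) : Prop :=
  ∃ w : Word S, Positive w ∧ wbar A w = g

/-- An `H`-transversal: a subset containing `1` and exactly one element of each left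
`H`-coset. -/
def IsLeftTransversal {G : Type*} [Group G] (H : Subgroup G) (T : Set G) : Prop :=
  (1 : G) ∈ T ∧ ∀ g : G, ∃! x, x ∈ T ∧ g⁻¹ * x ∈ H

/-! ### Properties H, H⁺, H# -/

/-- Property `H`: `w →_{0,1,2} ε ↔ w̄ = 1`. -/
def PropertyH (A : ArtinData S) : Prop :=
  ∀ w : Word S, Steps012 A w [] ↔ wbar A w = 1

/-- Property `H⁺`: every word representing an element of a standard parabolic subgroup
`A_{S₀}` can be transformed by `→_{0,1,2⋆}` into a word over `S₀ ∪ S₀⁻¹`. -/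
def PropertyHPlus (A : ArtinData S) : Prop :=
  ∀ (S₀ : Set S) (w : Word S), wbar A w ∈ parab A S₀ →
    ∃ w₀ : Word S, WordOver S₀ w₀ ∧ Steps012Star A w w₀

/-- Property `H#` with respect to an `S`-sequence of transversals `T`. -/
def PropertyHSharpWrt (A : ArtinData S) (T : Set S → Set (ArtinGroup A)) : Prop :=
  (∀ S₀ : Set S, IsLeftTransversal (parab A S₀) (T S₀)) ∧
    ∀ (S' S₀ : Set S) (w : Word S), wbar A w ∈ parab A S' →
      ∃ v u : Word S, WordOver S' v ∧ WordOver (S' ∩ S₀) u ∧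
        Steps012 A w (v ++ u) ∧ wbar A v ∈ T S₀

/-- Property `H#`: property `H#` with respect to some `S`-sequence of transversals. -/
def PropertyHSharp (A : ArtinData S) : Prop :=
  ∃ T : Set S → Set (ArtinGroup A), PropertyHSharpWrt A T

/-! ### Critical words and the involution τ (relative to a dihedral pair) -/

/-- The permutation `δ` induced by conjugation by `Δ`, extended letterwise to words:
the identity if `M` is even, and the swap of `s` and `t` if `M` is odd. -/
noncomputable def deltaMap (s t : S) (M : ℕ) (w : Word S) : Word S :=
  if Even M then w
  else w.map fun l => (if l.1 = s then t else if l.1 = t then s else l.1, l.2)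

/-- `w` is an unsigned critical word (of the dihedral pair `{s,t}` with label `M`) and
`w' = τ(w)`. -/
def UCritTauPair (A : ArtinData S) (s t : S) (M : ℕ) (w w' : Word S) : Prop :=
  WordOver {s, t} w ∧ FreelyReduced w ∧ Unsigned w ∧ GeodesicOver A {s, t} w ∧
  pfun M w + nfun M w = M ∧
  ∃ (x y z z' : S) (wm : Word S),
    ({x, y} : Set S) = {s, t} ∧ ({z, z'} : Set S) = {s, t} ∧
    ((w = altWord x y (pfun M w) ++ wm ++ wordInv (altWord z z' (nfun M w)) ∧
      w' = wordInv (altWordR x y (nfun M w)) ++ deltaMap s t M wm ++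
        altWordR z z' (pfun M w)) ∨
     (w = wordInv (altWordR x y (nfun M w)) ++ wm ++ altWordR z z' (pfun M w) ∧
      w' = altWord x y (pfun M w) ++ deltaMap s t M wm ++
        wordInv (altWord z z' (nfun M w))))

/-- `w` is a positive critical word (of the dihedral pair `{s,t}` with label `M`) and
`w' = τ(w)`. -/
def PosCritTauPair (A : ArtinData S) (s t : S) (M : ℕ) (w w' : Word S) : Prop :=
  WordOver {s, t} w ∧ Positive w ∧ pfun M w = M ∧
  ∃ (x y : S) (wm : Word S), ({x, y} : Set S) = {s, t} ∧ pfun M wm < M ∧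
    ((w = altWord x y M ++ wm ∧
      (w' = deltaMap s t M wm ++ altWordR x y M ∨
       w' = deltaMap s t M wm ++ altWordR y x M) ∧
      w'.getLast? ≠ w.getLast?) ∨
     (w = wm ++ altWordR x y M ∧
      (w' = altWord x y M ++ deltaMap s t M wm ∨
       w' = altWord y x M ++ deltaMap s t M wm) ∧
      w'.head? ≠ w.head?))

/-- `w` is a negative critical word and `w' = τ(w)` (defined via formal inverses). -/
def NegCritTauPair (A : ArtinData S) (s t : S) (M : ℕ) (w w' : Word S) : Prop :=
  PosCritTauPair A s t M (wordInv w) (wordInv w')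

/-- `w` is a critical word (unsigned, positive or negative) and `w' = τ(w)`. -/
def CritTauPair (A : ArtinData S) (s t : S) (M : ℕ) (w w' : Word S) : Prop :=
  UCritTauPair A s t M w w' ∨ PosCritTauPair A s t M w w' ∨ NegCritTauPair A s t M w w'

/-- A type β transformation relative to the dihedral pair `{s,t}` with label `M`:
replace a critical factor `v` by `τ(v)`. -/
def StepBetaPair (A : ArtinData S) (s t : S) (M : ℕ) (w w' : Word S) : Prop :=
  ∃ (w₁ w₂ v v' : Word S), w = w₁ ++ v ++ w₂ ∧ w' = w₁ ++ v' ++ w₂ ∧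
    CritTauPair A s t M v v'

/-- A type β transformation (in an Artin–Tits group): a type β transformation relative to some
dihedral standard parabolic subgroup (a pair of generators with finite label). -/
def StepBeta (A : ArtinData S) (w w' : Word S) : Prop :=
  ∃ (s t : S) (M : ℕ), s ≠ t ∧ A.m s t = (M : ℕ∞) ∧ StepBetaPair A s t M w w'

/-! ### Restriction, direct products, Coxeter graph notions -/

/-- The Artin–Tits presentation induced on a subset `T` of the generators (the presentation of
the standard parabolic subgroup `A_T`). -/
def ArtinData.restrict (A : ArtinData S) (T : Set S) : ArtinData T where
  m a b := A.m a b
  symm a b := A.symm a b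
  two_le a b h := A.two_le a b fun h' => h (Subtype.ext h')

/-- The Artin–Tits presentation on the disjoint union `S₁ ⊕ S₂` obtained from presentations on
`S₁` and `S₂` by adding the commuting relations `s₁s₂ = s₂s₁` (label `2`) for `s₁ ∈ S₁`,
`s₂ ∈ S₂`. -/
def prodData {S₁ S₂ : Type*} (A₁ : ArtinData S₁) (A₂ : ArtinData S₂) :
    ArtinData (S₁ ⊕ S₂) where
  m x y :=
    match x, y with
    | Sum.inl a, Sum.inl b => A₁.m a b
    | Sum.inr a, Sum.inr b => A₂.m a b
    | _, _ => 2
  symm x y := by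
    cases x <;> cases y
    · exact A₁.symm _ _
    · rfl
    · rfl
    · exact A₂.symm _ _
  two_le x y h := by
    cases x <;> cases y
    · exact A₁.two_le _ _ fun h' => h (congrArg Sum.inl h')
    · exact le_rfl
    · exact le_rfl
    · exact A₂.two_le _ _ fun h' => h (congrArg Sum.inr h')

/-- Adjacency in the Coxeter graph `Γ` restricted to `T`: distinct vertices of `T` joined by an
edge (i.e. with label `≠ 2`, edges labelled `2` being removed in `Γ`). -/
def coxAdj (A : ArtinData S) (T : Set S) (x y : S) : Prop :=
  x ∈ T ∧ y ∈ T ∧ x ≠ y ∧ A.m x y ≠ 2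

/-- The full subgraph of the Coxeter graph on the vertex subset `T` is connected. -/
def CoxConnected (A : ArtinData S) (T : Set S) : Prop :=
  ∀ x ∈ T, ∀ y ∈ T, Relation.ReflTransGen (coxAdj A T) x y

/-- The relator set of the Coxeter presentation on `T`: the Artin relations together with the
squares of the generators. -/
def coxRels (A : ArtinData S) (T : Set S) : Set (FreeGroup T) :=
  rels (A.restrict T) ∪ {g | ∃ x : T, g = FreeGroup.of x * FreeGroup.of x}

/-- The induced presentation on `T` is of spherical type: its Coxeter group is finite. -/
def SphericalType (A : ArtinData S) (T : Set S) : Prop :=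
  Finite (PresentedGroup (coxRels A T))

/-- The induced presentation on `T` is of large type: all labels are `≥ 3` (possibly `∞`). -/
def LargeTypeOn (A : ArtinData S) (T : Set S) : Prop :=
  ∀ x ∈ T, ∀ y ∈ T, x ≠ y → 3 ≤ A.m x y

/-! ### Words and homomorphisms -/

section Words

variable {S' : Type*}

lemma mk_wordInv (w : Word S) :
    FreeGroup.mk (wordInv w) = (FreeGroup.mk w)⁻¹ := by
  rw [FreeGroup.inv_mk, wordInv, FreeGroup.invRev, List.map_reverse]

lemma mk_append (u v : Word S) :
    FreeGroup.mk (u ++ v) = FreeGroup.mk u * FreeGroup.mk v :=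
  FreeGroup.mul_mk.symm

lemma wbar_append (A : ArtinData S) (u v : Word S) :
    wbar A (u ++ v) = wbar A u * wbar A v := by
  rw [wbar, mk_append, map_mul]; rfl

lemma wbar_nil (A : ArtinData S) : wbar A [] = 1 := map_one _

lemma wordOver_append {T : Set S} {u v : Word S} :
    WordOver T (u ++ v) ↔ WordOver T u ∧ WordOver T v := by
  simp only [WordOver, List.mem_append, or_imp, forall_and]

lemma wordOver_wordInv {T : Set S} {w : Word S} :
    WordOver T (wordInv w) ↔ WordOver T w := by
  simp only [WordOver, wordInv, List.map_reverse, List.mem_reverse, List.forall_mem_map]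

lemma wordOver_altWord {T : Set S} (k : ℕ) {x y : S} (hx : x ∈ T) (hy : y ∈ T) :
    WordOver T (altWord x y k) := by
  induction k generalizing x y with
  | zero => simp [WordOver, altWord]
  | succ k ih =>
    intro l hl
    rcases List.mem_cons.1 hl with rfl | hl
    · exact hx
    · exact ih hy hx l hl

lemma altWord_succ_eq_concat (x y : S) (k : ℕ) :
    altWord x y (k + 1) = altWord x y k ++ [(if Even k then x else y, true)] := by
  induction k generalizing x y with
  | zero => simp [altWord]
  | succ k ih =>
    rw [altWord, ih, altWord]
    by_cases h : Even k <;> simp [h, Nat.even_add_one]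

lemma mem_of_wordOver_altWord {T : Set S} {k : ℕ} (hk : 2 ≤ k) {x y : S}
    (h : WordOver T (altWord x y k)) : x ∈ T ∧ y ∈ T := by
  obtain ⟨k, rfl⟩ := Nat.exists_eq_add_of_le' hk
  simp only [altWord] at h
  exact ⟨h (x, true) (by simp), h (y, true) (by simp)⟩

lemma mem_of_wordOver_left_factors {T : Set S} {k : ℕ} {x y : S} {u₁ u₂ v₁ v₂ : Word S}
    (hu : u₁ ++ u₂ = altWord x y k) (hv : v₁ ++ v₂ = altWord y x k)
    (hu₁ : u₁ ≠ []) (hv₁ : v₁ ≠ []) (hTu : WordOver T u₁) (hTv : WordOver T v₁) :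
    x ∈ T ∧ y ∈ T := by
  obtain ⟨a, u₁, rfl⟩ := List.exists_cons_of_ne_nil hu₁
  obtain ⟨b, v₁, rfl⟩ := List.exists_cons_of_ne_nil hv₁
  have ha := hTu a (by simp)
  have hb := hTv b (by simp)
  cases k with
  | zero => simp [altWord] at hu
  | succ k =>
    simp only [altWord, List.cons_append, List.cons.injEq] at hu hv
    rw [hu.1] at ha
    rw [hv.1] at hb
    exact ⟨ha, hb⟩

lemma mem_of_wordOver_right_factors {T : Set S} {k : ℕ} {x y : S} {u₁ u₂ v₁ v₂ : Word S}
    (hu : u₁ ++ u₂ = altWord x y k) (hv : v₁ ++ v₂ = altWord y x k)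
    (hu₂ : u₂ ≠ []) (hv₂ : v₂ ≠ []) (hTu : WordOver T u₂) (hTv : WordOver T v₂) :
    x ∈ T ∧ y ∈ T := by
  obtain ⟨u₂, a, rfl⟩ := List.eq_nil_or_concat' u₂ |>.resolve_left hu₂
  obtain ⟨v₂, b, rfl⟩ := List.eq_nil_or_concat' v₂ |>.resolve_left hv₂
  have ha := hTu a (by simp)
  have hb := hTv b (by simp)
  cases k with
  | zero => simp [altWord] at hu
  | succ k =>
    rw [altWord_succ_eq_concat, ← List.append_assoc] at hu hv
    rw [(List.append_inj' hu rfl).2 |> List.singleton_injective] at ha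
    rw [(List.append_inj' hv rfl).2 |> List.singleton_injective] at hb
    by_cases h : Even k
    · simp only [h, if_true] at ha hb; exact ⟨ha, hb⟩
    · simp only [h, if_false] at ha hb; exact ⟨hb, ha⟩

lemma ArtinData.two_le_of_eq (A : ArtinData S) {s t : S} {k : ℕ} (hst : s ≠ t)
    (hk : A.m s t = k) : 2 ≤ k := by
  have := A.two_le s t hst
  rw [hk] at this
  exact_mod_cast this

/-- The transformations of types 0, 1 and 2 starting from a word over `T` stay over `T` and
do not change the image under any homomorphism compatible with the relations of `T`. -/
lemma wordOver_and_map_eq_of_step (A : ArtinData S) {G : Type*} [Group G] (T : Set S)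
    (e : FreeGroup S →* G)
    (he : ∀ s ∈ T, ∀ t ∈ T, ∀ k : ℕ, s ≠ t → A.m s t = k →
      e (FreeGroup.mk (altWord s t k)) = e (FreeGroup.mk (altWord t s k)))
    {w w' : Word S} (hw : WordOver T w) (h : Step0 w w' ∨ Step1 A w w' ∨ Step2 A w w') :
    WordOver T w' ∧ e (FreeGroup.mk w') = e (FreeGroup.mk w) := by
  rcases h with ⟨w₁, w₂, s, b, rfl, rfl⟩ | ⟨w₁, w₂, u, v, ⟨s, t, k, hst, hk, rfl, rfl⟩, h⟩ |
    ⟨w₁, w₂, u₁, u₂, v₁, v₂, ⟨s, t, k, hst, hk, hu, hv⟩, hu₁, hv₁, rfl, rfl⟩ |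
    ⟨w₁, w₂, u₁, u₂, v₁, v₂, ⟨s, t, k, hst, hk, hu, hv⟩, hu₂, hv₂, rfl, rfl⟩
  · rw [wordOver_append, wordOver_append] at hw
    refine ⟨wordOver_append.2 ⟨hw.1.1, hw.2⟩, congrArg e ?_⟩
    exact (Quot.sound (by simp)).symm
  · rcases h with ⟨rfl, rfl⟩ | ⟨rfl, rfl⟩
    all_goals
      simp only [wordOver_append, wordOver_wordInv] at hw ⊢
      obtain ⟨ht, hs⟩ := mem_of_wordOver_altWord (A.two_le_of_eq hst hk) hw.1.2
      refine ⟨⟨⟨hw.1.1, wordOver_altWord k hs ht⟩, hw.2⟩, ?_⟩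
      simp only [mk_append, mk_wordInv, map_mul, map_inv, he s hs t ht k hst hk]
  · simp only [wordOver_append, wordOver_wordInv] at hw ⊢
    obtain ⟨hs, ht⟩ := mem_of_wordOver_left_factors hu hv hu₁ hv₁ hw.1.2 hw.1.1.2
    have hu' := wordOver_altWord (T := T) k hs ht
    have hv' := wordOver_altWord (T := T) k ht hs
    rw [← hu, wordOver_append] at hu'
    rw [← hv, wordOver_append] at hv'
    refine ⟨⟨⟨⟨hw.1.1.1, hv'.2⟩, hu'.2⟩, hw.2⟩, ?_⟩
    have key := he s hs t ht k hst hk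
    rw [← hu, ← hv, mk_append, mk_append, map_mul, map_mul] at key
    have key' := eq_mul_inv_of_mul_eq key
    simp only [mk_append, mk_wordInv, map_mul, map_inv]
    rw [key']
    group
  · simp only [wordOver_append, wordOver_wordInv] at hw ⊢
    obtain ⟨hs, ht⟩ := mem_of_wordOver_right_factors hu hv hu₂ hv₂ hw.1.2 hw.1.1.2
    have hu' := wordOver_altWord (T := T) k hs ht
    have hv' := wordOver_altWord (T := T) k ht hs
    rw [← hu, wordOver_append] at hu'
    rw [← hv, wordOver_append] at hv'
    refine ⟨⟨⟨⟨hw.1.1.1, hv'.1⟩, hu'.1⟩, hw.2⟩, ?_⟩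
    have key := he s hs t ht k hst hk
    rw [← hu, ← hv, mk_append, mk_append, map_mul, map_mul] at key
    have key' := eq_mul_inv_of_mul_eq key
    simp only [mk_append, mk_wordInv, map_mul, map_inv]
    rw [key']
    group

lemma wordOver_and_map_eq_of_steps012 (A : ArtinData S) {G : Type*} [Group G] (T : Set S)
    (e : FreeGroup S →* G)
    (he : ∀ s ∈ T, ∀ t ∈ T, ∀ k : ℕ, s ≠ t → A.m s t = k →
      e (FreeGroup.mk (altWord s t k)) = e (FreeGroup.mk (altWord t s k)))
    {w w' : Word S} (hw : WordOver T w) (h : Steps012 A w w') :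
    WordOver T w' ∧ e (FreeGroup.mk w') = e (FreeGroup.mk w) := by
  induction h with
  | refl => exact ⟨hw, rfl⟩
  | tail _ hstep ih =>
    have := wordOver_and_map_eq_of_step A T e he ih.1 hstep
    exact ⟨this.1, this.2.trans ih.2⟩

lemma wbar_altWord (A : ArtinData S) {s t : S} {k : ℕ} (hst : s ≠ t) (hk : A.m s t = k) :
    wbar A (altWord s t k) = wbar A (altWord t s k) := by
  refine mul_inv_eq_one.1 ?_
  have : FreeGroup.mk (altWord s t k) * (FreeGroup.mk (altWord t s k))⁻¹ ∈ rels A :=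
    ⟨_, _, ⟨s, t, k, hst, hk, rfl, rfl⟩, rfl⟩
  rw [wbar, wbar, ← map_inv, ← map_mul]
  exact (QuotientGroup.eq_one_iff _).2 (Subgroup.subset_normalClosure this)

lemma wbar_eq_of_steps012 (A : ArtinData S) {w w' : Word S} (h : Steps012 A w w') :
    wbar A w' = wbar A w :=
  (wordOver_and_map_eq_of_steps012 A Set.univ (PresentedGroup.mk (rels A))
    (fun _ _ _ _ _ hst hk => wbar_altWord A hst hk) (fun _ _ => Set.mem_univ _) h).2

lemma Step2Star.step2 {A : ArtinData S} {w w' : Word S} (h : Step2Star A w w') :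
    Step2 A w w' := by
  rcases h with ⟨w₁, w₂, v, u, v', u', hr, hv, hv', rfl, rfl, -, -⟩ |
    ⟨w₁, w₂, v, u, v', u', ⟨s, t, k, hst, hk, hu, hu'⟩, hv, hv', rfl, rfl, -, -⟩
  · obtain ⟨s, t, k, hst, hk, hu, hu'⟩ := hr
    exact Or.inl ⟨w₁, w₂, v', u', v, u, ⟨t, s, k, hst.symm, A.symm s t ▸ hk, hu', hu⟩,
      hv', hv, rfl, rfl⟩
  · exact Or.inr ⟨w₁, w₂, u', v', u, v, ⟨t, s, k, hst.symm, A.symm s t ▸ hk, hu', hu⟩,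
      hv', hv, rfl, rfl⟩

lemma Steps012Star.steps012 {A : ArtinData S} {w w' : Word S} (h : Steps012Star A w w') :
    Steps012 A w w' :=
  Relation.ReflTransGen.mono (fun _ _ => Or.imp_right (Or.imp_right Step2Star.step2)) _ _ h

/-- The image of a word under a map of the generators. -/
def mapWord (f : S → S') (w : Word S) : Word S' := w.map fun l => (f l.1, l.2)

@[simp] lemma mapWord_nil (f : S → S') : mapWord f [] = [] := rfl

@[simp] lemma mapWord_append (f : S → S') (u v : Word S) :
    mapWord f (u ++ v) = mapWord f u ++ mapWord f v := List.map_append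

@[simp] lemma mapWord_eq_nil {f : S → S'} {w : Word S} : mapWord f w = [] ↔ w = [] :=
  List.map_eq_nil_iff

@[simp] lemma mapWord_wordInv (f : S → S') (w : Word S) :
    mapWord f (wordInv w) = wordInv (mapWord f w) := by
  simp [mapWord, wordInv, Function.comp_def]

@[simp] lemma mapWord_altWord (f : S → S') (x y : S) (k : ℕ) :
    mapWord f (altWord x y k) = altWord (f x) (f y) k := by
  induction k generalizing x y with
  | zero => rfl
  | succ k ih => rw [altWord, altWord, ← ih]; rfl

lemma wordOver_range_iff {f : S → S'} {w : Word S'} :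
    WordOver (Set.range f) w ↔ ∃ w₀, mapWord f w₀ = w := by
  constructor
  · intro h
    induction w with
    | nil => exact ⟨[], rfl⟩
    | cons a w ih =>
      obtain ⟨w₀, rfl⟩ := ih fun l hl => h l (List.mem_cons_of_mem _ hl)
      obtain ⟨x, hx⟩ := h a List.mem_cons_self
      refine ⟨(x, a.2) :: w₀, ?_⟩
      simp only [mapWord, List.map_cons, hx]
  · rintro ⟨w₀, rfl⟩ l hl
    obtain ⟨l₀, -, rfl⟩ := List.mem_map.1 hl
    exact ⟨_, rfl⟩

/-- A map of generators is an embedding of Artin–Tits presentations. -/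
structure IsEmb (A : ArtinData S) (A' : ArtinData S') (f : S → S') : Prop where
  injective : Function.Injective f
  label : ∀ a b, A'.m (f a) (f b) = A.m a b

namespace IsEmb

variable {A : ArtinData S} {A' : ArtinData S'} {f : S → S'}

lemma isRel (hf : IsEmb A A' f) {u v : Word S} (h : IsRel A u v) :
    IsRel A' (mapWord f u) (mapWord f v) := by
  obtain ⟨s, t, k, hst, hk, rfl, rfl⟩ := h
  exact ⟨f s, f t, k, hf.injective.ne hst, (hf.label s t).trans hk, by simp, by simp⟩

lemma steps012 (hf : IsEmb A A' f) {w w' : Word S} (h : Steps012 A w w') :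
    Steps012 A' (mapWord f w) (mapWord f w') := by
  refine Relation.ReflTransGen.lift (mapWord f) ?_ _ _ h
  rintro _ _ (⟨w₁, w₂, s, b, rfl, rfl⟩ | ⟨w₁, w₂, u, v, hr, h⟩ |
    ⟨w₁, w₂, u₁, u₂, v₁, v₂, hr, hu₁, hv₁, rfl, rfl⟩ |
    ⟨w₁, w₂, u₁, u₂, v₁, v₂, hr, hu₂, hv₂, rfl, rfl⟩)
  · exact Or.inl ⟨mapWord f w₁, mapWord f w₂, f s, b, by simp [mapWord], by simp⟩
  · refine Or.inr (Or.inl ⟨mapWord f w₁, mapWord f w₂, _, _, hf.isRel hr, ?_⟩)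
    rcases h with ⟨rfl, rfl⟩ | ⟨rfl, rfl⟩ <;> simp
  · exact Or.inr (Or.inr (Or.inl ⟨mapWord f w₁, mapWord f w₂, mapWord f u₁, mapWord f u₂,
      mapWord f v₁, mapWord f v₂, by simpa using hf.isRel hr, by simpa, by simpa,
      by simp, by simp⟩))
  · exact Or.inr (Or.inr (Or.inr ⟨mapWord f w₁, mapWord f w₂, mapWord f u₁, mapWord f u₂,
      mapWord f v₁, mapWord f v₂, by simpa using hf.isRel hr, by simpa, by simpa,
      by simp, by simp⟩))

end IsEmb

/-- The homomorphism out of an Artin–Tits group induced by a map on the generators which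
respects the defining relations. -/
def artinLift (A : ArtinData S) {G : Type*} [Group G] (f : S → G)
    (h : ∀ (s t : S) (k : ℕ), s ≠ t → A.m s t = k →
      FreeGroup.lift f (FreeGroup.mk (altWord s t k)) =
        FreeGroup.lift f (FreeGroup.mk (altWord t s k))) :
    ArtinGroup A →* G :=
  PresentedGroup.toGroup (f := f) (by
    rintro _ ⟨_, _, ⟨s, t, k, hst, hk, rfl, rfl⟩, rfl⟩
    rw [map_mul, map_inv, h s t k hst hk, mul_inv_cancel])

lemma artinLift_wbar (A : ArtinData S) {G : Type*} [Group G] (f : S → G)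
    (h : ∀ (s t : S) (k : ℕ), s ≠ t → A.m s t = k →
      FreeGroup.lift f (FreeGroup.mk (altWord s t k)) =
        FreeGroup.lift f (FreeGroup.mk (altWord t s k))) (w : Word S) :
    artinLift A f h (wbar A w) = FreeGroup.lift f (FreeGroup.mk w) := rfl

lemma wbar_surjective (A : ArtinData S) (g : ArtinGroup A) : ∃ w, wbar A w = g := by
  obtain ⟨x, rfl⟩ := PresentedGroup.mk_surjective (rels A) g
  exact ⟨x.toWord, congrArg _ FreeGroup.mk_toWord⟩

lemma lift_mk_mapWord {G : Type*} [Group G] (f : S → S') (g : S' → G) (w : Word S) :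
    FreeGroup.lift g (FreeGroup.mk (mapWord f w)) =
      FreeGroup.lift (g ∘ f) (FreeGroup.mk w) := by
  simp [FreeGroup.lift_mk, mapWord, Function.comp_def]

lemma lift_wbar_singleton (A : ArtinData S) (w : Word S) :
    FreeGroup.lift (fun s => wbar A [(s, true)]) (FreeGroup.mk w) = wbar A w :=
  DFunLike.congr_fun (FreeGroup.ext_hom _ _ fun s => by rw [FreeGroup.lift_apply_of]; rfl :
    FreeGroup.lift (fun s => wbar A [(s, true)]) = PresentedGroup.mk (rels A)) _

/-- The homomorphism of Artin–Tits groups induced by an embedding of presentations. -/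
def mapHom {A : ArtinData S} {A' : ArtinData S'} {f : S → S'} (hf : IsEmb A A' f) :
    ArtinGroup A →* ArtinGroup A' :=
  artinLift A ((fun s => wbar A' [(s, true)]) ∘ f) fun s t k hst hk => by
    rw [← lift_mk_mapWord, ← lift_mk_mapWord, lift_wbar_singleton, lift_wbar_singleton,
      mapWord_altWord, mapWord_altWord]
    exact wbar_altWord A' (hf.injective.ne hst) ((hf.label s t).trans hk)

lemma mapHom_wbar {A : ArtinData S} {A' : ArtinData S'} {f : S → S'} (hf : IsEmb A A' f)
    (w : Word S) : mapHom hf (wbar A w) = wbar A' (mapWord f w) := by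
  rw [mapHom, artinLift_wbar, ← lift_mk_mapWord, lift_wbar_singleton]

lemma wbar_mem_parab (A : ArtinData S) {T : Set S} {w : Word S} (hw : WordOver T w) :
    wbar A w ∈ parab A T := by
  induction w with
  | nil => exact wbar_nil A ▸ one_mem _
  | cons a w ih =>
    have ha : wbar A [(a.1, true)] ∈ parab A T :=
      Subgroup.subset_closure ⟨a.1, hw a List.mem_cons_self, rfl⟩
    rw [← List.singleton_append, wbar_append]
    refine mul_mem ?_ (ih fun l hl => hw l (List.mem_cons_of_mem _ hl))
    obtain ⟨s, b⟩ := a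
    cases b with
    | true => exact ha
    | false => exact inv_mem ha

lemma PropertyHPlus.steps012_nil {A : ArtinData S} (hA : PropertyHPlus A) {w : Word S}
    (hw : wbar A w = 1) : Steps012 A w [] := by
  obtain ⟨w₀, h₀, h⟩ := hA ∅ w (hw ▸ one_mem _)
  rw [List.eq_nil_iff_forall_not_mem.2 h₀] at h
  exact h.steps012

/-- Property `H⁺` makes the canonical maps from the standard parabolic presentations
injective. -/
lemma mapHom_injective {A : ArtinData S} {A' : ArtinData S'} {f : S → S'}
    (hf : IsEmb A A' f) (hA' : PropertyHPlus A') : Function.Injective (mapHom hf) := by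
  refine (injective_iff_map_eq_one _).2 fun g hg => ?_
  obtain ⟨w, rfl⟩ := wbar_surjective A g
  rw [mapHom_wbar] at hg
  let r : S' → ArtinGroup A := fun x => if h : ∃ s, f s = x then wbar A [(h.choose, true)] else 1
  have hr : r ∘ f = fun s => wbar A [(s, true)] := by
    funext s
    have h : ∃ s', f s' = f s := ⟨s, rfl⟩
    simp only [r, Function.comp_apply, dif_pos h, hf.injective h.choose_spec]
  have key := (wordOver_and_map_eq_of_steps012 A' (Set.range f) (FreeGroup.lift r) (by
    rintro _ ⟨s, rfl⟩ _ ⟨t, rfl⟩ k hst hk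
    rw [← mapWord_altWord, ← mapWord_altWord, lift_mk_mapWord, lift_mk_mapWord, hr,
      lift_wbar_singleton, lift_wbar_singleton]
    exact wbar_altWord A (fun h => hst (congrArg f h)) ((hf.label s t).symm.trans hk))
    (wordOver_range_iff.2 ⟨w, rfl⟩) (hA'.steps012_nil hg)).2
  rw [lift_mk_mapWord, hr, lift_wbar_singleton] at key
  exact key.symm.trans (map_one _)

lemma isEmb_val (A : ArtinData S) (T : Set S) : IsEmb (A.restrict T) A Subtype.val :=
  ⟨Subtype.val_injective, fun _ _ => rfl⟩

lemma isEmb_inclusion (A : ArtinData S) {U T : Set S} (h : U ⊆ T) :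
    IsEmb (A.restrict U) (A.restrict T) (Set.inclusion h) :=
  ⟨Set.inclusion_injective h, fun _ _ => rfl⟩

lemma Steps012.append {A : ArtinData S} {u v : Word S} (h : Steps012 A u v) (a b : Word S) :
    Steps012 A (a ++ u ++ b) (a ++ v ++ b) := by
  refine Relation.ReflTransGen.lift (fun x => a ++ x ++ b) ?_ _ _ h
  rintro _ _ (⟨w₁, w₂, s, c, rfl, rfl⟩ | ⟨w₁, w₂, u, v, hr, h⟩ |
    ⟨w₁, w₂, u₁, u₂, v₁, v₂, hr, hu₁, hv₁, rfl, rfl⟩ |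
    ⟨w₁, w₂, u₁, u₂, v₁, v₂, hr, hu₂, hv₂, rfl, rfl⟩)
  · exact Or.inl ⟨a ++ w₁, w₂ ++ b, s, c, by simp, by simp⟩
  · refine Or.inr (Or.inl ⟨a ++ w₁, w₂ ++ b, _, _, hr, ?_⟩)
    rcases h with ⟨rfl, rfl⟩ | ⟨rfl, rfl⟩ <;> simp
  · exact Or.inr (Or.inr (Or.inl ⟨a ++ w₁, w₂ ++ b, u₁, u₂, v₁, v₂, hr, hu₁, hv₁,
      by simp, by simp⟩))
  · exact Or.inr (Or.inr (Or.inr ⟨a ++ w₁, w₂ ++ b, u₁, u₂, v₁, v₂, hr, hu₂, hv₂,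
      by simp, by simp⟩))

end Words

/-! ### Amalgamated products of parabolic subgroups -/

section Amalgam

variable {ι : Type*} (A : ArtinData S) (T : ι → Set S)

/-- The word over `S` underlying a sequence of words over the subsets `T i`. -/
def flat (L : List (Σ i, Word (T i))) : Word S := L.flatMap fun x => mapWord Subtype.val x.2

variable {T}

@[simp] lemma flat_nil : flat T [] = [] := rfl

@[simp] lemma flat_cons (x : Σ i, Word (T i)) (L : List (Σ i, Word (T i))) :
    flat T (x :: L) = mapWord Subtype.val x.2 ++ flat T L := rfl

@[simp] lemma flat_append (L L' : List (Σ i, Word (T i))) :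
    flat T (L ++ L') = flat T L ++ flat T L' := List.flatMap_append

variable {U : Set S}

/-- The maps defining the amalgamated product of the `A_{T i}` over `A_U`. -/
def amalgMap (hU : ∀ i, U ⊆ T i) (i : ι) :
    ArtinGroup (A.restrict U) →* ArtinGroup (A.restrict (T i)) :=
  mapHom (isEmb_inclusion A (hU i))

lemma amalgMap_injective (hU : ∀ i, U ⊆ T i) (hH : ∀ i, PropertyHPlus (A.restrict (T i)))
    (i : ι) : Function.Injective (amalgMap A hU i) :=
  mapHom_injective _ (hH i)

/-- A word over `T i` representing an element of `A_U` can be rewritten over `U`. -/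
lemma exists_steps012_of_mem_range (hU : ∀ i, U ⊆ T i)
    (hH : ∀ i, PropertyHPlus (A.restrict (T i))) {i : ι} {w : Word (T i)}
    (hw : wbar (A.restrict (T i)) w ∈ (amalgMap A hU i).range) :
    ∃ u : Word U, Steps012 A (mapWord Subtype.val w) (mapWord Subtype.val u) := by
  obtain ⟨g, hg⟩ := hw
  obtain ⟨v, rfl⟩ := wbar_surjective _ g
  rw [amalgMap, mapHom_wbar] at hg
  obtain ⟨w₀, h₀, h⟩ := hH i (Set.range (Set.inclusion (hU i))) w
    (hg ▸ wbar_mem_parab _ (wordOver_range_iff.2 ⟨v, rfl⟩))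
  obtain ⟨u, rfl⟩ := wordOver_range_iff.1 h₀
  refine ⟨u, ?_⟩
  have := (isEmb_val A (T i)).steps012 h.steps012
  rwa [show mapWord Subtype.val (mapWord (Set.inclusion (hU i)) u) = mapWord Subtype.val u by
    simp [mapWord, Function.comp_def]] at this

variable (hU : ∀ i, U ⊆ T i) (hTU : ∀ i j, i ≠ j → T i ∩ T j ⊆ U)
  (hcov : ∀ s, ∃ i, s ∈ T i)
  (hrel : ∀ (s t : S) (k : ℕ), s ≠ t → A.m s t = k → ∃ i, s ∈ T i ∧ t ∈ T i)

/-- The images of the generators in the amalgamated product. -/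
noncomputable def amalgGen (s : S) : Monoid.PushoutI (amalgMap A hU) :=
  Monoid.PushoutI.of (hcov s).choose
    (wbar (A.restrict (T (hcov s).choose)) [(⟨s, (hcov s).choose_spec⟩, true)])

include hTU in
lemma amalgGen_eq {s : S} {i : ι} (hs : s ∈ T i) :
    amalgGen A hU hcov s =
      Monoid.PushoutI.of i (wbar (A.restrict (T i)) [(⟨s, hs⟩, true)]) := by
  have aux : ∀ (j : ι) (hj : s ∈ T j),
      (Monoid.PushoutI.of j (wbar (A.restrict (T j)) [(⟨s, hj⟩, true)]) :
        Monoid.PushoutI (amalgMap A hU)) =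
      Monoid.PushoutI.of i (wbar (A.restrict (T i)) [(⟨s, hs⟩, true)]) := by
    intro j hj
    by_cases hij : j = i
    · subst hij; rfl
    · have hsU := hTU j i hij ⟨hj, hs⟩
      have base : ∀ (l : ι) (hl : s ∈ T l),
          (Monoid.PushoutI.of l (wbar (A.restrict (T l)) [(⟨s, hl⟩, true)]) :
            Monoid.PushoutI (amalgMap A hU)) =
          Monoid.PushoutI.base (amalgMap A hU) (wbar (A.restrict U) [(⟨s, hsU⟩, true)]) := by
        intro l hl
        rw [← Monoid.PushoutI.of_apply_eq_base (amalgMap A hU) l, amalgMap, mapHom_wbar]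
        rfl
      rw [base j hj, base i hs]
  exact aux _ _

include hTU in
lemma lift_amalgGen {i : ι} (w : Word (T i)) :
    FreeGroup.lift (amalgGen A hU hcov) (FreeGroup.mk (mapWord Subtype.val w)) =
      Monoid.PushoutI.of i (wbar (A.restrict (T i)) w) := by
  rw [lift_mk_mapWord]
  refine DFunLike.congr_fun (f := FreeGroup.lift (amalgGen A hU hcov ∘ Subtype.val))
    (g := (Monoid.PushoutI.of i).comp (PresentedGroup.mk (rels (A.restrict (T i)))))
    (FreeGroup.ext_hom _ _ fun s => ?_) (FreeGroup.mk w)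
  rw [FreeGroup.lift_apply_of]
  exact amalgGen_eq A hU hTU hcov s.2

/-- The canonical homomorphism from `A_S` to the amalgamated product. -/
noncomputable def toAmalg : ArtinGroup A →* Monoid.PushoutI (amalgMap A hU) :=
  artinLift A (amalgGen A hU hcov) fun s t k hst hk => by
    obtain ⟨i, hs, ht⟩ := hrel s t k hst hk
    have h₁ := lift_amalgGen A hU hTU hcov (altWord (⟨s, hs⟩ : T i) ⟨t, ht⟩ k)
    have h₂ := lift_amalgGen A hU hTU hcov (altWord (⟨t, ht⟩ : T i) ⟨s, hs⟩ k)
    rw [mapWord_altWord] at h₁ h₂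
    rw [h₁, h₂, wbar_altWord (A.restrict (T i)) (s := ⟨s, hs⟩) (t := ⟨t, ht⟩)
      (fun h => hst (congrArg Subtype.val h)) hk]

lemma toAmalg_wbar {i : ι} (w : Word (T i)) :
    toAmalg A hU hTU hcov hrel (wbar A (mapWord Subtype.val w)) =
      Monoid.PushoutI.of i (wbar (A.restrict (T i)) w) :=
  lift_amalgGen A hU hTU hcov w

lemma toAmalg_wbar_flat (L : List (Σ i, Word (T i))) :
    toAmalg A hU hTU hcov hrel (wbar A (flat T L)) =
      (L.map fun x => Monoid.PushoutI.of x.1 (wbar (A.restrict (T x.1)) x.2)).prod := by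
  induction L with
  | nil => simp [wbar_nil]
  | cons x L ih =>
    rw [flat_cons, wbar_append, map_mul, ih, toAmalg_wbar, List.map_cons, List.prod_cons]

include hU hTU hcov hrel in
/-- A sequence of words over the `T i`, none of which represents an element of `A_U` and with
no two neighbours over the same `T i`, represents `1` only if it is empty. -/
lemma eq_nil_of_reduced (hH : ∀ i, PropertyHPlus (A.restrict (T i)))
    {L : List (Σ i, Word (T i))} (hL : wbar A (flat T L) = 1)
    (hchain : L.IsChain fun x y => x.1 ≠ y.1)
    (hred : ∀ x ∈ L, wbar (A.restrict (T x.1)) x.2 ∉ (amalgMap A hU x.1).range) : L = [] := by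
  let W : Monoid.CoprodI.Word fun i => ArtinGroup (A.restrict (T i)) :=
    { toList := L.map fun x => ⟨x.1, wbar (A.restrict (T x.1)) x.2⟩
      ne_one := by
        intro l hl h1
        obtain ⟨x, hx, rfl⟩ := List.mem_map.1 hl
        exact hred x hx (by rw [show wbar (A.restrict (T x.1)) x.2 = 1 from h1]; exact one_mem _)
      chain_ne := (List.isChain_map _).2 hchain }
  have hW : Monoid.PushoutI.Reduced (amalgMap A hU) W := by
    intro l hl
    obtain ⟨x, hx, rfl⟩ := List.mem_map.1 hl
    exact hred x hx
  have hprod : Monoid.PushoutI.ofCoprodI W.prod = (1 : Monoid.PushoutI (amalgMap A hU)) := by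
    have h := toAmalg_wbar_flat A hU hTU hcov hrel L
    rw [hL, map_one] at h
    rw [h, Monoid.CoprodI.Word.prod, map_list_prod, List.map_map, List.map_map]
    congr 1
  have hnil := hW.eq_empty_of_mem_range (amalgMap_injective A hU hH) (hprod ▸ one_mem _)
  exact List.map_eq_nil_iff.1 (congrArg Monoid.CoprodI.Word.toList hnil)

include hU hTU hcov hrel in
lemma steps012_flat_nil (hH : ∀ i, PropertyHPlus (A.restrict (T i)))
    (L : List (Σ i, Word (T i))) (hL : wbar A (flat T L) = 1) :
    Steps012 A (flat T L) [] := by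
  induction hn : L.length using Nat.strong_induction_on generalizing L with
  | _ n ih =>
  have reduce : ∀ L' : List (Σ i, Word (T i)), Steps012 A (flat T L) (flat T L') →
      L'.length < L.length → Steps012 A (flat T L) [] := fun L' hs hl =>
    hs.trans (ih _ (hn ▸ hl) L' ((wbar_eq_of_steps012 A hs).trans hL) rfl)
  by_cases hchain : L.IsChain fun x y => x.1 ≠ y.1
  swap
  · rw [List.isChain_iff_forall_rel_of_append_cons_cons] at hchain
    push Not at hchain
    obtain ⟨⟨i, u⟩, ⟨j, v⟩, a, b, rfl, hij⟩ := hchain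
    obtain rfl : i = j := hij
    refine reduce (a ++ ⟨i, u ++ v⟩ :: b) ?_ (by simp)
    simp only [flat_append, flat_cons, mapWord_append, List.append_assoc]
    exact Relation.ReflTransGen.refl
  by_cases hred : ∀ x ∈ L, wbar (A.restrict (T x.1)) x.2 ∉ (amalgMap A hU x.1).range
  · rw [eq_nil_of_reduced A hU hTU hcov hrel hH hL hchain hred]
    exact Relation.ReflTransGen.refl
  push Not at hred
  obtain ⟨x, hx, hmem⟩ := hred
  obtain ⟨a, b, rfl⟩ := List.append_of_mem hx
  obtain ⟨u, hu⟩ := exists_steps012_of_mem_range A hU hH hmem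
  have hval : ∀ i, mapWord Subtype.val (mapWord (Set.inclusion (hU i)) u) =
      mapWord Subtype.val u := fun i => by simp [mapWord, Function.comp_def]
  have hstep := hu.append (flat T a) (flat T b)
  cases b with
  | cons y b =>
    refine reduce (a ++ ⟨y.1, mapWord (Set.inclusion (hU y.1)) u ++ y.2⟩ :: b) ?_ (by simp)
    simpa [hval] using hstep
  | nil =>
    rcases List.eq_nil_or_concat' a with rfl | ⟨a, y, rfl⟩
    · simp only [List.nil_append, flat_cons, flat_nil, List.append_nil] at hL ⊢
      have h := toAmalg_wbar A hU hTU hcov hrel x.2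
      rw [hL, map_one] at h
      have h1 := Monoid.PushoutI.of_injective (amalgMap_injective A hU hH) x.1
        ((map_one _).trans h)
      exact (isEmb_val A (T x.1)).steps012 ((hH x.1).steps012_nil h1.symm)
    · refine reduce (a ++ [⟨y.1, y.2 ++ mapWord (Set.inclusion (hU y.1)) u⟩]) ?_ (by simp)
      simpa [hval] using hstep

include hU hTU hcov hrel in
/-- An Artin–Tits group which is an amalgamated product of standard parabolic subgroups
satisfying Property `H⁺` satisfies Property `H`. -/
lemma propertyH_of_amalgam (hH : ∀ i, PropertyHPlus (A.restrict (T i))) : PropertyH A := by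
  refine fun w => ⟨fun h => (wbar_eq_of_steps012 A h).symm.trans (wbar_nil A), fun h => ?_⟩
  obtain ⟨L, rfl⟩ : ∃ L : List (Σ i, Word (T i)), flat T L = w := by
    clear h
    induction w with
    | nil => exact ⟨[], rfl⟩
    | cons l w ih =>
      obtain ⟨L, rfl⟩ := ih
      obtain ⟨i, hi⟩ := hcov l.1
      exact ⟨⟨i, [(⟨l.1, hi⟩, l.2)]⟩ :: L, rfl⟩
  exact steps012_flat_nil A hU hTU hcov hrel hH L h

end Amalgam

/-- Proposition 3.4: if `S = S₁ ∪ S₂`, the group `A_S` is the amalgamated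
product of `A_{S₁}` and `A_{S₂}` over `A_{S₁∩S₂}` (equivalently, every pair of generators
lying on the two different sides has label `∞`), and the three induced presentations satisfy
Property `H⁺`, then `(S,R)` satisfies Property `H`. -/
theorem stmt14 {S : Type*} [Finite S] (A : ArtinData S) (S₁ S₂ : Set S)
    (hunion : S₁ ∪ S₂ = Set.univ)
    (hamalg : ∀ s₁ ∈ S₁ \ S₂, ∀ s₂ ∈ S₂ \ S₁, A.m s₁ s₂ = ⊤)
    (h1 : PropertyHPlus (A.restrict S₁))
    (h2 : PropertyHPlus (A.restrict S₂))
    (h12 : PropertyHPlus (A.restrict (S₁ ∩ S₂))) :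
    PropertyH A := by
  have hcov : ∀ s, s ∈ S₁ ∨ s ∈ S₂ := fun s => hunion.ge (Set.mem_univ s)
  refine propertyH_of_amalgam A (T := fun i => bif i then S₁ else S₂) (U := S₁ ∩ S₂)
    (hU := ?_) (hTU := ?_) (hcov := ?_) (hrel := ?_) (hH := ?_)
  · rintro (_ | _)
    exacts [Set.inter_subset_right, Set.inter_subset_left]
  · rintro (_ | _) (_ | _) h x ⟨hx, hx'⟩
    exacts [absurd rfl h, ⟨hx', hx⟩, ⟨hx, hx'⟩, absurd rfl h]
  · exact fun s => (hcov s).elim (fun h => ⟨true, h⟩) fun h => ⟨false, h⟩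
  · intro s t k _ hk
    by_contra! hno
    have hs₁ : s ∈ S₁ → t ∉ S₁ := hno true
    have hs₂ : s ∈ S₂ → t ∉ S₂ := hno false
    have htop : A.m s t = ⊤ := by
      rcases hcov s with hs | hs
      · have ht := (hcov t).resolve_left (hs₁ hs)
        exact hamalg s ⟨hs, fun h => hs₂ h ht⟩ t ⟨ht, hs₁ hs⟩
      · have ht := (hcov t).resolve_right (hs₂ hs)
        rw [A.symm]
        exact hamalg t ⟨ht, hs₂ hs⟩ s ⟨hs, fun h => hs₁ h ht⟩
    exact ENat.natCast_ne_top k (hk.symm.trans htop)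
  · rintro (_ | _)
    exacts [h2, h1]

end ArtinTits
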